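/- Let q be a prime power and n ≥ 1 an integer. There is a constant C(n,q) > 0 such that for every integer k > 0, with R = A/t^kA, every subset E ⊆ R^n, and every λ > 0, the number of primitive vectors w ∈ S^{n−1}(R) with 𝟙_E*(w) ≥ λ is at most C(n,q) · k^n · λ^{−n} · |E|, where 𝟙_E denotes the characteristic function of E. -/

import Mathlib

open scoped Classical
noncomputable section

/-- `Rk Fq k` is the quotient ring `R = A/t^k A` where `A = 𝔽_q[[t]]`. -/
abbrev Rk (Fq : Type) [Field Fq] (k : ℕ) : Type :=
  PowerSeries Fq ⧸ Ideal.span {(PowerSeries.X : PowerSeries Fq) ^ k}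

/-- The image of `t` in `R = A/t^k A`. -/
def tbar (Fq : Type) [Field Fq] (k : ℕ) : Rk Fq k :=
  Ideal.Quotient.mk _ PowerSeries.X

/-- The set `S^{n-1}(R) = R^n ∖ (tR)^n` of primitive vectors of `R^n`. -/
def primSet (Fq : Type) [Field Fq] (n k : ℕ) : Set (Fin n → Rk Fq k) :=
  {w | ¬ ∀ i, ∃ r : Rk Fq k, w i = tbar Fq k * r}

/-- The line in `R^n` through `b` in the direction of `w`. -/
def rline {Fq : Type} [Field Fq] {n k : ℕ} (b w : Fin n → Rk Fq k) :
    Set (Fin n → Rk Fq k) :=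
  {v | ∃ r : Rk Fq k, v = fun i => b i + r * w i}

/-- The discrete Kakeya maximal function
`φ*(w) = sup_{ℓ ∥ w} q^{-k} Σ_{v ∈ ℓ} |φ(v)|`. -/
def maxFn (Fq : Type) [Field Fq] [Fintype Fq] {n k : ℕ}
    (φ : (Fin n → Rk Fq k) → ℝ) (w : Fin n → Rk Fq k) : ℝ :=
  ⨆ b : Fin n → Rk Fq k,
    ((Fintype.card Fq : ℝ) ^ k)⁻¹ * ∑ᶠ v ∈ rline b w, |φ v|

/-- A strict tangent line inequality for the convex function `s ↦ q ^ s` at an integer `K`. -/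
lemma pow_tangent_lt {q : ℕ} (hq : 2 ≤ q) {K s : ℕ} (h : s ≠ K) :
    (q : ℤ) ^ K * (2 * q + (2 * q - 1) * ((s : ℤ) - K)) < 2 * q * (q : ℤ) ^ s := by
  have hq' : (2 : ℤ) ≤ q := by exact_mod_cast hq
  rcases lt_or_gt_of_ne h with h | h
  · obtain ⟨a, rfl⟩ := Nat.exists_eq_add_of_lt h
    have hs : (0 : ℤ) < (q : ℤ) ^ s := by positivity
    have ha : (0 : ℤ) < (q : ℤ) ^ a := by positivity
    push_cast
    rcases Nat.eq_zero_or_pos a with rfl | h1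
    · simp only [add_zero, pow_succ, Nat.cast_zero]
      nlinarith [mul_pos hs (by linarith : (0 : ℤ) < q)]
    · have h1' : (1 : ℤ) ≤ a := by exact_mod_cast h1
      have : (2 * (q : ℤ) + (2 * q - 1) * (s - (s + a + 1))) < 0 := by nlinarith
      have h2 : (0 : ℤ) < (q : ℤ) ^ (s + a + 1) := by positivity
      have h3 : (0 : ℤ) < 2 * q * (q : ℤ) ^ s := by positivity
      nlinarith [mul_neg_of_pos_of_neg h2 this]
  · obtain ⟨a, rfl⟩ := Nat.exists_eq_add_of_lt h
    have hK : (0 : ℤ) < (q : ℤ) ^ K := by positivity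
    have hb : 1 + ((a : ℤ) + 1) * (q - 1) ≤ (q : ℤ) ^ (a + 1) := by
      have := one_add_mul_le_pow (a := (q : ℤ) - 1) (by linarith) (a + 1)
      push_cast at this
      simpa using this
    have : (q : ℤ) ^ (K + a + 1) = (q : ℤ) ^ K * (q : ℤ) ^ (a + 1) := by ring
    rw [this]
    push_cast
    have h4 : 2 * (q : ℤ) + (2 * q - 1) * (K + a + 1 - K) < 2 * q * (q : ℤ) ^ (a + 1) := by
      have h0 : (0 : ℤ) ≤ a := by positivity
      have h5 : 1 + ((a : ℤ) + 1) ≤ (q : ℤ) ^ (a + 1) := by nlinarith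
      nlinarith
    nlinarith [mul_lt_mul_of_pos_left h4 hK]

lemma pow_tangent_le {q : ℕ} (hq : 2 ≤ q) (K s : ℕ) :
    (q : ℤ) ^ K * (2 * q + (2 * q - 1) * ((s : ℤ) - K)) ≤ 2 * q * (q : ℤ) ^ s := by
  rcases eq_or_ne s K with rfl | h
  · simp; linarith
  · exact (pow_tangent_lt hq h).le

/-- The equality case of the tangent line inequality for `q ^ s` at `s = K`, summed over `s`. -/
lemma eq_of_sum_pow_eq {q : ℕ} (hq : 2 ≤ q) {ι : Type*} [Fintype ι] (K : ℕ) (s : ι → ℕ)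
    (hsum : ∑ i, q ^ s i = q ^ K * Fintype.card ι) (hs : K * Fintype.card ι ≤ ∑ i, s i) (i : ι) :
    s i = K := by
  by_contra h
  have hlt := Finset.sum_lt_sum (s := Finset.univ) (fun i _ => pow_tangent_le hq K (s i))
    ⟨i, Finset.mem_univ i, pow_tangent_lt hq h⟩
  rw [← Finset.mul_sum, ← Finset.mul_sum, Finset.sum_add_distrib, ← Finset.mul_sum,
    ← Finset.mul_sum, Finset.sum_sub_distrib] at hlt
  have h1 : ∑ i, (q : ℤ) ^ s i = q ^ K * Fintype.card ι := by exact_mod_cast hsum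
  have h2 : (K : ℤ) * Fintype.card ι ≤ ∑ i, (s i : ℤ) := by exact_mod_cast hs
  rw [h1] at hlt
  simp only [Finset.sum_const, Finset.card_univ, nsmul_eq_mul] at hlt
  have hq' : (2 : ℤ) ≤ q := by exact_mod_cast hq
  have hK : (0 : ℤ) < (q : ℤ) ^ K := by positivity
  have h3 : 0 ≤ (2 * (q : ℤ) - 1) * (∑ i, (s i : ℤ) - Fintype.card ι * K) :=
    mul_nonneg (by linarith) (by linarith)
  nlinarith [mul_nonneg hK.le h3]

open Polynomial in
/-- The product of powers of truncated twisted linear forms, expanded. -/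
lemma prod_sum_pow_expand {κ : Type*} [CommRing κ] {n K : ℕ} (q : ℕ)
    (α : Fin n × Fin K → ℕ) (W : Fin n × Fin (K + 1) → κ) :
    ∏ p, (∑ j : Fin (K + 1), (C (W (p.1, j)) * X ^ q ^ (j + p.2 : ℕ) : κ[X])) ^ α p =
      ∑ x : (Σ p : Fin n × Fin K, Fin (α p)) → Fin (K + 1),
        C (∏ u, W (u.1.1, x u)) * X ^ (∑ u, q ^ (x u + u.1.2 : ℕ)) := by
  calc _ = ∏ p, ∏ _u : Fin (α p), ∑ j : Fin (K + 1),
        (C (W (p.1, j)) * X ^ q ^ (j + p.2 : ℕ) : κ[X]) := by simp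
    _ = ∏ u : (Σ p : Fin n × Fin K, Fin (α p)), ∑ j : Fin (K + 1),
        (C (W (u.1.1, j)) * X ^ q ^ (j + u.1.2 : ℕ) : κ[X]) := by
      rw [Fintype.prod_sigma]
    _ = _ := by
      rw [Finset.prod_univ_sum]
      simp [Finset.prod_mul_distrib, Finset.prod_pow_eq_pow_sum]

/-- A digit vector is determined by the leading monomial of the product it indexes, among those of
the same degree and no smaller level weight. -/
lemma eq_of_monomial_eq {q : ℕ} (hq : 2 ≤ q) {n K : ℕ} (α β : Fin n × Fin K → ℕ)
    (hl : ∑ p, α p = ∑ p, β p → ∑ p, p.2 * β p ≤ ∑ p, p.2 * α p)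
    (x : (Σ p : Fin n × Fin K, Fin (α p)) → Fin (K + 1))
    (hJ : ∑ u, q ^ (x u + u.1.2 : ℕ) = q ^ K * ∑ p, β p)
    (ht : ∑ u, Finsupp.single (u.1.1, x u) 1 =
      ∑ p : Fin n × Fin K, Finsupp.single (p.1, p.2.castSucc.rev) (β p)) :
    α = β ∧ ∀ u, x u = u.1.2.castSucc.rev := by
  have hcard : Fintype.card (Σ p : Fin n × Fin K, Fin (α p)) = ∑ p, α p := by simp
  have hdeg : ∑ p, α p = ∑ p, β p := by
    have := congrArg Finsupp.degree ht
    simpa [map_sum] using this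
  have hw : ∑ u, (x u : ℕ) = ∑ p : Fin n × Fin K, β p * (K - p.2) := by
    have := congrArg (Finsupp.weight (fun v : Fin n × Fin (K + 1) => (v.2 : ℕ))) ht
    simpa [map_sum, Finsupp.weight_single] using this
  have hw' : ∑ u, (x u : ℕ) + ∑ p : Fin n × Fin K, p.2 * β p = K * ∑ p, β p := by
    rw [hw, ← Finset.sum_add_distrib, Finset.mul_sum]
    refine Finset.sum_congr rfl fun p _ => ?_
    have := p.2.2
    obtain ⟨c, hc⟩ := Nat.exists_eq_add_of_le this.le
    rw [Nat.sub_eq_of_eq_add (by omega : K = c + p.2)]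
    nlinarith
  have hlev : ∑ u : (Σ p : Fin n × Fin K, Fin (α p)), (u.1.2 : ℕ) =
      ∑ p : Fin n × Fin K, p.2 * α p := by
    rw [Fintype.sum_sigma]
    simp [mul_comm]
  have key := eq_of_sum_pow_eq hq K (fun u => (x u + u.1.2 : ℕ))
    (by rw [hcard, hdeg, hJ]) (by
      rw [hcard, Finset.sum_add_distrib, hlev, hdeg]
      have := hl hdeg
      omega)
  have hx : ∀ u, x u = u.1.2.castSucc.rev := fun u => by
    have := key u
    ext
    simp
    omega
  refine ⟨?_, hx⟩
  have hinj : Function.Injective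
      fun p : Fin n × Fin K => (p.1, p.2.castSucc.rev) := by
    rintro ⟨a, b⟩ ⟨c, d⟩ h
    simpa using h
  have ht' : ∑ p : Fin n × Fin K, Finsupp.single (p.1, p.2.castSucc.rev) (α p) =
      ∑ p : Fin n × Fin K, Finsupp.single (p.1, p.2.castSucc.rev) (β p) := by
    rw [← ht, Fintype.sum_sigma]
    refine Finset.sum_congr rfl fun p _ => ?_
    simp only [hx]
    simp
  funext p
  have := DFunLike.congr_fun ht' (p.1, p.2.castSucc.rev)
  simpa [Finsupp.finsetSum_apply, Finsupp.single_apply, hinj.eq_iff, Prod.ext_iff,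
    Fintype.sum_prod_type, ite_and] using this

open Polynomial in
/-- A nonzero combination of products of powers of twisted linear forms has a nonzero coefficient
of low degree at some specialization of the variables, with prescribed constant terms. -/
theorem exists_coeff_ne_zero {F κ : Type*} [Field F] [Fintype F] [Field κ] [Algebra F κ] {n K : ℕ}
    {q : ℕ} (hqdef : Fintype.card F = q) (f : (Fin n × Fin K → Fin q) → κ) (hf : f ≠ 0) :
    ∃ w : Fin n × Fin (K + 1) → F, (∀ i, w (i, 0) = 1) ∧
      ∃ J ≤ q ^ K * (n * K * (q - 1)),
        (∑ α, C (f α) * ∏ p, (∑ j : Fin (K + 1), (C (algebraMap F κ (w (p.1, j))) *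
          X ^ q ^ (j + p.2 : ℕ) : κ[X])) ^ (α p : ℕ)).coeff J ≠ 0 := by
  have hq : 2 ≤ q := hqdef ▸ Fintype.one_lt_card
  obtain ⟨α₀, hα₀⟩ : ∃ α, f α ≠ 0 := Function.ne_iff.mp hf
  obtain ⟨α₁, hα₁, hmax⟩ := Finset.exists_max_image (Finset.univ.filter fun α => f α ≠ 0)
    (fun α => ∑ p, (α p : ℕ)) ⟨α₀, by simpa using hα₀⟩
  obtain ⟨β, hβ, hmin⟩ := Finset.exists_min_image
    (Finset.univ.filter fun α => f α ≠ 0 ∧ ∑ p, (α p : ℕ) = ∑ p, (α₁ p : ℕ))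
    (fun α => ∑ p, (p.2 : ℕ) * (α p : ℕ)) ⟨α₁, by simpa using hα₁⟩
  simp only [Finset.mem_filter, Finset.mem_univ, true_and] at hβ hmin hmax
  set J := q ^ K * ∑ p, (β p : ℕ) with hJdef
  set t : Fin n × Fin (K + 1) →₀ ℕ :=
    ∑ p : Fin n × Fin K, Finsupp.single (p.1, p.2.castSucc.rev) (β p : ℕ) with htdef
  have hinj : Function.Injective
      fun p : Fin n × Fin K => (p.1, p.2.castSucc.rev) := by
    rintro ⟨a, b⟩ ⟨c, d⟩ h
    simpa using h
  let P : MvPolynomial (Fin n × Fin (K + 1)) κ :=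
    ∑ α : Fin n × Fin K → Fin q, ∑ x : (Σ p : Fin n × Fin K, Fin (α p)) → Fin (K + 1),
      if ∑ u, q ^ (x u + u.1.2 : ℕ) = J then
        MvPolynomial.monomial (∑ u, Finsupp.single (u.1.1, x u) 1) (f α) else 0
  have heval : ∀ W : Fin n × Fin (K + 1) → κ, MvPolynomial.eval W P =
      (∑ α, C (f α) * ∏ p, (∑ j : Fin (K + 1), (C (W (p.1, j)) *
          X ^ q ^ (j + p.2 : ℕ) : κ[X])) ^ (α p : ℕ)).coeff J := by
    intro W
    simp only [P, map_sum, finsetSum_coeff]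
    refine Finset.sum_congr rfl fun α _ => ?_
    rw [prod_sum_pow_expand q (fun p => (α p : ℕ)) W, coeff_C_mul, finsetSum_coeff,
      Finset.mul_sum]
    refine Finset.sum_congr rfl fun x _ => ?_
    rw [coeff_C_mul, coeff_X_pow]
    by_cases h : J = ∑ u, q ^ (x u + u.1.2 : ℕ)
    · rw [if_pos h.symm, if_pos h, MvPolynomial.eval_monomial, mul_one]
      congr 1
      rw [← Finsupp.prod_finsetSum_index (by simp) (by simp [pow_add])]
      simp
    · rw [if_neg (Ne.symm h), if_neg h]
      simp
  have hcoeff : MvPolynomial.coeff t P = f β := by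
    simp only [P, MvPolynomial.coeff_sum]
    rw [Finset.sum_eq_single β, Finset.sum_eq_single fun u => u.1.2.castSucc.rev]
    · rw [if_pos, MvPolynomial.coeff_monomial, if_pos]
      · rw [Fintype.sum_sigma]
        simp [htdef]
      · rw [Fintype.sum_sigma, hJdef, Finset.mul_sum]
        refine Finset.sum_congr rfl fun p _ => ?_
        have : (p.2.castSucc.rev : ℕ) + p.2 = K := by simp
        simp only [this]
        simp [mul_comm]
    · intro x _ hx
      split_ifs with h
      · rw [MvPolynomial.coeff_monomial, if_neg]
        intro h'
        exact hx (funext (eq_of_monomial_eq hq (fun p => (β p : ℕ)) (fun p => (β p : ℕ))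
          (fun _ => le_rfl) x h h').2)
      · simp
    · simp
    · intro α _ hα
      by_cases hfα : f α = 0
      · simp [hfα]
      refine Finset.sum_eq_zero fun x _ => ?_
      split_ifs with h
      · rw [MvPolynomial.coeff_monomial, if_neg]
        intro h'
        refine hα (funext fun p => Fin.ext (congrFun (eq_of_monomial_eq hq (fun p => (α p : ℕ))
          (fun p => (β p : ℕ)) ?_ x h h').1 p))
        intro h2
        exact hmin α ⟨hfα, h2.trans hβ.2⟩
      · simp
    · simp
  have hne : MvPolynomial.coeff t P ≠ 0 := hcoeff ▸ hβ.1
  have htdeg : t.degree = ∑ p, (β p : ℕ) := by simp [htdef, map_sum]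
  have hdeg : P.totalDegree = t.degree := by
    refine le_antisymm ?_ (MvPolynomial.le_totalDegree (MvPolynomial.mem_support_iff.2 hne))
    refine MvPolynomial.totalDegree_finsetSum_le fun α _ => ?_
    refine MvPolynomial.totalDegree_finsetSum_le fun x _ => ?_
    split_ifs
    · by_cases hfα : f α = 0
      · simp [hfα]
      refine (MvPolynomial.totalDegree_monomial_le _ _).trans ?_
      rw [htdeg, hβ.2]
      refine le_trans (le_of_eq ?_) (hmax α hfα)
      change Finsupp.degree _ = _
      simp [map_sum]
    · simp
  obtain ⟨W, hW, hPW⟩ := MvPolynomial.combinatorial_nullstellensatz_exists_eval_nonzero P t hne hdeg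
    (fun v => if v.2 = 0 then {1} else Finset.univ.image (algebraMap F κ)) (by
      rintro ⟨i, j⟩
      by_cases hj : j = 0
      · subst hj
        simp only [htdef, Finsupp.finsetSum_apply, if_true, Finset.card_singleton, Nat.lt_one_iff]
        refine Finset.sum_eq_zero fun p _ => Finsupp.single_eq_of_ne ?_
        intro h
        have := congrArg (fun v => (v.2 : ℕ)) h
        have := p.2.2
        simp at *
        omega
      · rw [if_neg hj, Finset.card_image_of_injective _ (algebraMap F κ).injective,
          Finset.card_univ, hqdef, htdef, Finsupp.finsetSum_apply]
        by_cases hex : ∃ p : Fin n × Fin K, (p.1, p.2.castSucc.rev) = (i, j)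
        · obtain ⟨p, hp⟩ := hex
          rw [← hp, Finset.sum_eq_single p]
          · simp
          · intro p' _ hp'
            exact Finsupp.single_eq_of_ne fun h => hp' (hinj h.symm)
          · simp
        · rw [Finset.sum_eq_zero]
          · omega
          · intro p _
            exact Finsupp.single_eq_of_ne fun h => hex ⟨p, h.symm⟩)
  have hex : ∀ v : Fin n × Fin (K + 1), ∃ a : F, algebraMap F κ a = W v ∧ (v.2 = 0 → a = 1) := by
    intro v
    have := hW v
    by_cases hv : v.2 = 0
    · rw [if_pos hv] at this
      exact ⟨1, by simpa using (Finset.mem_singleton.1 this).symm, fun _ => rfl⟩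
    · rw [if_neg hv] at this
      obtain ⟨a, -, ha⟩ := Finset.mem_image.1 this
      exact ⟨a, ha, fun h => absurd h hv⟩
  choose w hw1 hw2 using hex
  refine ⟨w, fun i => hw2 _ rfl, J, ?_, ?_⟩
  · refine Nat.mul_le_mul_left _ ?_
    calc ∑ p, (β p : ℕ) ≤ ∑ _p : Fin n × Fin K, (q - 1) :=
          Finset.sum_le_sum fun p _ => by have := (β p).2; omega
      _ = _ := by simp
  · rw [heval] at hPW
    simpa only [hw1] using hPW

section TwistedAction

open Polynomial

variable {F : Type*} [Field F] [Fintype F] {S T : Type*} [CommRing S] [Algebra F S]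
  [CommRing T] [Algebra F T]

variable (F) in
/-- The `F`-linear endomorphism `y ↦ y ^ q + s * y`, where `q` is the cardinality of `F`. -/
def carlitz (s : S) : Module.End F S :=
  (FiniteField.frobeniusAlgHom F S).toLinearMap + LinearMap.mulLeft F s

lemma carlitz_apply (s y : S) : carlitz F s y = y ^ Fintype.card F + s * y := rfl

/-- The action of `F[X]` on an `F`-algebra in which `X` acts by `carlitz F s`. -/
def carlitzAct (s : S) (p : F[X]) (y : S) : S := aeval (carlitz F s) p y

lemma carlitzAct_mul (s : S) (p r : F[X]) (y : S) :
    carlitzAct s (p * r) y = carlitzAct s p (carlitzAct s r y) := by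
  simp [carlitzAct]

lemma carlitzAct_add (s : S) (p r : F[X]) (y : S) :
    carlitzAct s (p + r) y = carlitzAct s p y + carlitzAct s r y := by
  simp [carlitzAct]

lemma carlitzAct_sub (s : S) (p r : F[X]) (y : S) :
    carlitzAct s (p - r) y = carlitzAct s p y - carlitzAct s r y := by
  simp [carlitzAct]

lemma carlitzAct_apply_zero (s : S) (p : F[X]) : carlitzAct s p (0 : S) = 0 := by
  simp [carlitzAct]

lemma carlitzAct_X_pow (s : S) (k : ℕ) (y : S) :
    carlitzAct s (X ^ k : F[X]) y = (carlitz F s ^ k) y := by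
  simp [carlitzAct]

lemma carlitzAct_eq_sum (s : S) (p : F[X]) {N : ℕ} (hN : p.natDegree < N) (y : S) :
    carlitzAct s p y = ∑ i ∈ Finset.range N, p.coeff i • (carlitz F s ^ i) y := by
  rw [carlitzAct, aeval_eq_sum_range' hN]
  simp

lemma map_carlitz_pow (φ : S →ₐ[F] T) (s y : S) (i : ℕ) :
    φ ((carlitz F s ^ i) y) = (carlitz F (φ s) ^ i) (φ y) := by
  induction i with
  | zero => simp
  | succ i ih => simp [pow_succ', carlitz_apply, ih]

lemma map_carlitzAct (φ : S →ₐ[F] T) (s : S) (p : F[X]) (y : S) :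
    φ (carlitzAct s p y) = carlitzAct (φ s) p (φ y) := by
  simp [carlitzAct_eq_sum _ _ (Nat.lt_succ_self _), map_sum, map_carlitz_pow]

lemma carlitz_zero_pow (i : ℕ) (y : S) :
    (carlitz F (0 : S) ^ i) y = y ^ Fintype.card F ^ i := by
  induction i with
  | zero => simp
  | succ i ih => simp [pow_succ', carlitz_apply, ih, ← pow_mul, mul_comm]

lemma carlitzAct_eq_of_X_pow_dvd {s y : S} {k : ℕ} (hy : (carlitz F s ^ k) y = 0) {p r : F[X]}
    (h : X ^ k ∣ p - r) : carlitzAct s p y = carlitzAct s r y := by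
  obtain ⟨u, hu⟩ := h
  rw [← sub_eq_zero, ← carlitzAct_sub, hu, mul_comm, carlitzAct_mul, carlitzAct_X_pow, hy,
    carlitzAct_apply_zero]

lemma X_pow_dvd_of_carlitzAct_eq_zero [IsDomain S] {s y : S} {k : ℕ}
    (hy : (carlitz F s ^ (k + 1)) y = 0) (hy' : (carlitz F s ^ k) y ≠ 0) {p : F[X]}
    (h : carlitzAct s p y = 0) : X ^ (k + 1) ∣ p := by
  rw [X_pow_dvd_iff]
  intro d
  induction d using Nat.strong_induction_on with
  | _ d ih =>
    intro hd
    obtain ⟨u, hu⟩ : X ^ d ∣ p := X_pow_dvd_iff.2 fun e he => ih e he (he.trans hd)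
    have h1 : carlitzAct s (X ^ (k - d) * p) y = 0 := by
      rw [carlitzAct_mul, h, carlitzAct_apply_zero]
    have h2 : X ^ (k - d) * p = X ^ k * u := by
      rw [hu, ← mul_assoc, ← pow_add, Nat.sub_add_cancel (by omega)]
    rw [h2, carlitzAct_eq_of_X_pow_dvd hy (r := C (u.coeff 0) * X ^ k)] at h1
    · rw [carlitzAct_mul, carlitzAct_X_pow] at h1
      have h3 : (u.coeff 0) • (carlitz F s ^ k) y = 0 := by
        simpa [carlitzAct, Algebra.smul_def] using h1
      rw [hu, coeff_X_pow_mul', if_pos le_rfl, Nat.sub_self]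
      have := FaithfulSMul.algebraMap_injective F S
      rw [Algebra.smul_def, mul_eq_zero] at h3
      exact (map_eq_zero_iff _ this).1 (h3.resolve_right hy')
    · have : X ∣ u - C (u.coeff 0) := X_dvd_iff.2 (by simp)
      obtain ⟨c, hc⟩ := this
      exact ⟨c, by linear_combination X ^ k * hc⟩

end TwistedAction

section QuotientRing

open Polynomial

variable {F : Type} [Field F] {k : ℕ}

variable (F k) in
/-- The projection from polynomials to the truncated power series ring. -/
def polyToRk : F[X] →+* Rk F k := (Ideal.Quotient.mk _).comp coeToPowerSeries.ringHom

lemma polyToRk_eq_zero_iff {p : F[X]} : polyToRk F k p = 0 ↔ X ^ k ∣ p := by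
  rw [polyToRk, RingHom.comp_apply, Ideal.Quotient.eq_zero_iff_mem, Ideal.mem_span_singleton,
    PowerSeries.X_pow_dvd_iff, X_pow_dvd_iff]
  simp

lemma polyToRk_eq_iff {p r : F[X]} : polyToRk F k p = polyToRk F k r ↔ X ^ k ∣ p - r := by
  rw [← sub_eq_zero, ← map_sub, polyToRk_eq_zero_iff]

lemma exists_coeff_polyToRk_eq (r : Rk F k) :
    ∃ c : Fin k → F, polyToRk F k (∑ i, C (c i) * X ^ (i : ℕ)) = r := by
  obtain ⟨P, rfl⟩ := Ideal.Quotient.mk_surjective r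
  refine ⟨fun i => PowerSeries.coeff i P, ?_⟩
  rw [polyToRk, RingHom.comp_apply, Ideal.Quotient.eq, Ideal.mem_span_singleton,
    PowerSeries.X_pow_dvd_iff]
  intro m hm
  simp only [map_sub, coeToPowerSeries.ringHom_apply, coeff_coe, finsetSum_coeff, coeff_C_mul,
    coeff_X_pow]
  rw [Finset.sum_eq_single ⟨m, hm⟩]
  · simp
  · intro b _ hb
    rw [if_neg, mul_zero]
    intro h
    exact hb (Fin.ext h.symm)
  · simp

lemma polyToRk_surjective : Function.Surjective (polyToRk F k) := fun r =>
  (exists_coeff_polyToRk_eq r).imp' _ fun _ h => h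

instance [Fintype F] : Finite (Rk F k) :=
  Finite.of_surjective _ (exists_coeff_polyToRk_eq (F := F) (k := k))

lemma card_Rk_le [Fintype F] : Nat.card (Rk F k) ≤ Fintype.card F ^ k := by
  simpa using Nat.card_le_card_of_surjective _ (exists_coeff_polyToRk_eq (F := F) (k := k))

/-- A polynomial representative of an element of the truncated power series ring. -/
def rep (r : Rk F k) : F[X] := Function.surjInv polyToRk_surjective r

@[simp] lemma polyToRk_rep (r : Rk F k) : polyToRk F k (rep r) = r :=
  Function.surjInv_eq polyToRk_surjective r

lemma isUnit_of_not_tbar_dvd {r : Rk F k} (h : ¬ ∃ s, r = tbar F k * s) : IsUnit r := by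
  obtain ⟨P, rfl⟩ := Ideal.Quotient.mk_surjective r
  refine IsUnit.map _ (PowerSeries.isUnit_iff_constantCoeff.2 ?_)
  rw [isUnit_iff_ne_zero]
  intro h0
  obtain ⟨Q, rfl⟩ := PowerSeries.X_dvd_iff.2 h0
  exact h ⟨Ideal.Quotient.mk _ Q, by simp [tbar]⟩

lemma isUnit_polyToRk {p : F[X]} (h : p.coeff 0 ≠ 0) : IsUnit (polyToRk F k p) := by
  rw [polyToRk, RingHom.comp_apply]
  refine IsUnit.map _ (PowerSeries.isUnit_iff_constantCoeff.2 ?_)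
  simpa using h

end QuotientRing

section ValuationRing

open Polynomial IsLocalRing

/-- A valuation ring over `F` containing a cyclic torsion point for the twisted action, with all
data in the maximal ideal. -/
theorem exists_valuationRing_torsion (F : Type) [Field F] [Fintype F] (k : ℕ) :
    ∃ (O : Type) (_ : CommRing O) (_ : IsDomain O) (_ : ValuationRing O) (_ : Algebra F O)
      (s y : O), s ∈ maximalIdeal O ∧ y ∈ maximalIdeal O ∧
        (carlitz F s ^ (k + 1)) y = 0 ∧ (carlitz F s ^ k) y ≠ 0 := by
  let K := AlgebraicClosure (FractionRing (PowerSeries F))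
  let φ : PowerSeries F →+* K :=
    (algebraMap (FractionRing (PowerSeries F)) K).comp (algebraMap (PowerSeries F) _)
  have hφ : Function.Injective φ :=
    (algebraMap (FractionRing (PowerSeries F)) K).injective.comp (IsFractionRing.injective _ _)
  obtain ⟨A, hA, hloc⟩ := IsLocalRing.exists_factor_valuationRing φ
  let ψ : PowerSeries F →+* A := φ.codRestrict A.toSubring hA
  let : Algebra F A := (ψ.comp (algebraMap F (PowerSeries F))).toAlgebra
  have hroot : ∀ p : A[X], p.Monic → p.natDegree ≠ 0 → ∃ y, p.eval y = 0 := by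
    intro p hp hdeg
    obtain ⟨x, hx⟩ := IsAlgClosed.exists_root (p.map (algebraMap A K)) (by
      rw [hp.degree_map, degree_eq_natDegree hp.ne_zero]
      exact_mod_cast hdeg)
    have hxint : IsIntegral A x := ⟨p, hp, by rwa [IsRoot.def, eval_map] at hx⟩
    obtain ⟨y, rfl⟩ := IsIntegrallyClosed.isIntegral_iff.1 hxint
    refine ⟨y, ?_⟩
    rw [IsRoot.def, eval_map, eval₂_at_apply] at hx
    exact (map_eq_zero_iff _ (FaithfulSMul.algebraMap_injective A K)).1 hx
  have hq : 2 ≤ Fintype.card F := Fintype.one_lt_card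
  set s : A := ψ PowerSeries.X with hs
  have hs0 : s ≠ 0 := by
    intro h
    have : φ PowerSeries.X = 0 := congrArg Subtype.val h
    exact PowerSeries.X_ne_zero ((map_eq_zero_iff _ hφ).1 this)
  have hsm : s ∈ maximalIdeal A := by
    rw [mem_maximalIdeal, mem_nonunits_iff]
    intro h
    have h2 : IsUnit (PowerSeries.X : PowerSeries F) := hloc.map_nonunit _ h
    have := PowerSeries.isUnit_iff_constantCoeff.1 h2
    simp at this
  refine ⟨A, inferInstance, inferInstance, inferInstance, inferInstance, s, ?_⟩
  induction k with
  | zero =>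
    obtain ⟨y, hy⟩ := hroot (X ^ (Fintype.card F - 1) + C s)
      (monic_X_pow_add_C _ (by omega)) (by rw [natDegree_X_pow_add_C]; omega)
    simp only [eval_add, eval_pow, eval_X, eval_C] at hy
    refine ⟨y, hsm, ?_, ?_, ?_⟩
    · refine (maximalIdeal.isMaximal A).isPrime.mem_of_pow_mem (Fintype.card F - 1) ?_
      rw [eq_neg_of_add_eq_zero_left hy]
      exact neg_mem hsm
    · have : y ^ Fintype.card F = y ^ (Fintype.card F - 1) * y := by
        rw [← pow_succ, Nat.sub_add_cancel (by omega)]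
      simp only [zero_add, pow_one, carlitz_apply, this]
      linear_combination y * hy
    · rintro h
      simp only [pow_zero, Module.End.one_apply] at h
      rw [h, zero_pow (by omega), zero_add] at hy
      exact hs0 hy
  | succ k ih =>
    obtain ⟨y, -, hym, hy0, hy1⟩ := ih
    have hdeg : (C s * X - C y).degree < ((Fintype.card F : ℕ) : WithBot ℕ) := by
      refine lt_of_le_of_lt (b := ((1 : ℕ) : WithBot ℕ)) (by compute_degree!) ?_
      exact_mod_cast hq
    obtain ⟨x, hx⟩ := hroot (X ^ Fintype.card F + (C s * X - C y))
      (monic_X_pow_add hdeg) (by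
        rw [natDegree_eq_of_degree_eq (degree_add_eq_left_of_degree_lt (by simpa using hdeg)),
          natDegree_X_pow]
        omega)
    have hx' : carlitz F s x = y := by
      simp only [eval_add, eval_sub, eval_mul, eval_pow, eval_X, eval_C] at hx
      rw [carlitz_apply]
      linear_combination hx
    refine ⟨x, hsm, ?_, ?_, ?_⟩
    · refine (maximalIdeal.isMaximal A).isPrime.mem_of_pow_mem (Fintype.card F) ?_
      rw [eq_sub_of_add_eq ((carlitz_apply s x).symm.trans hx')]
      exact sub_mem hym (Ideal.mul_mem_right _ _ hsm)
    · rw [pow_succ, Module.End.mul_apply, hx', hy0]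
    · rwa [pow_succ, Module.End.mul_apply, hx']

lemma ValuationRing.exists_dvd_of_finset {O ι : Type*} [CommRing O] [IsDomain O] [ValuationRing O]
    (c : ι → O) {s : Finset ι} (hs : s.Nonempty) : ∃ i ∈ s, ∀ j ∈ s, c i ∣ c j := by
  induction hs using Finset.Nonempty.cons_induction with
  | singleton a => exact ⟨a, by simp, by simp⟩
  | cons a s ha hs ih =>
    obtain ⟨i, hi, h⟩ := ih
    rcases ValuationRing.dvd_total (c a) (c i) with h' | h'
    · exact ⟨a, by simp, by simpa using fun j hj => h'.trans (h j hj)⟩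
    · exact ⟨i, by simp [hi], by simpa using ⟨h', h⟩⟩

/-- A homogeneous linear system with more unknowns than equations over a valuation ring has a
solution one of whose entries is `1`. -/
lemma ValuationRing.exists_primitive_solution {O ι E : Type*} [CommRing O] [IsDomain O]
    [ValuationRing O] [Fintype ι] [Fintype E] (M : E → ι → O)
    (h : Fintype.card E < Fintype.card ι) :
    ∃ c : ι → O, (∃ i, c i = 1) ∧ ∀ e, ∑ i, c i * M e i = 0 := by
  have hni : ¬ Function.Injective (Matrix.mulVecLin (Matrix.of M)) := fun hinj =>
    absurd (card_le_of_injective O _ hinj) (not_le.2 h)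
  rw [← LinearMap.ker_eq_bot, Submodule.eq_bot_iff] at hni
  push Not at hni
  obtain ⟨c, hc, hc0⟩ := hni
  obtain ⟨i₁, hi₁⟩ := Function.ne_iff.1 hc0
  obtain ⟨i, -, hi⟩ := ValuationRing.exists_dvd_of_finset c (s := Finset.univ) ⟨i₁, by simp⟩
  have hci : c i ≠ 0 := fun h0 => hi₁ (by simpa [h0] using hi i₁ (by simp))
  choose d hd using fun j => hi j (Finset.mem_univ j)
  refine ⟨d, ⟨i, ?_⟩, fun e => ?_⟩
  · exact mul_left_cancel₀ hci (by rw [← hd i, mul_one])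
  · refine (mul_eq_zero.1 ?_).resolve_left hci
    have := congrFun (LinearMap.mem_ker.1 hc) e
    simp only [Matrix.mulVecLin_apply, Matrix.mulVec, dotProduct, Matrix.of_apply,
      Pi.zero_apply] at this
    rw [← this, Finset.mul_sum]
    refine Finset.sum_congr rfl fun j _ => ?_
    rw [hd j]
    ring

end ValuationRing

section PolynomialMethod

open Polynomial IsLocalRing

variable {F : Type} [Field F] [Fintype F] {k n : ℕ}

section Curve

variable (κ : Type) [CommRing κ] [Algebra F κ]

/-- The reduction of the line in the direction `w`, parametrized by polynomials. -/
def curve (w : Fin n → Rk F k) (i : Fin n) : κ[X] := carlitzAct 0 (rep (w i)) X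

variable {κ}

lemma coeff_aeval_congr {A B : Fin n → κ[X]} {N : ℕ} (h : ∀ i, X ^ N ∣ A i - B i)
    (f : MvPolynomial (Fin n) κ) {j : ℕ} (hj : j < N) :
    (MvPolynomial.aeval A f).coeff j = (MvPolynomial.aeval B f).coeff j := by
  have hAB : X ^ N ∣ MvPolynomial.aeval A f - MvPolynomial.aeval B f := by
    rw [← Ideal.mem_span_singleton, ← Ideal.Quotient.eq,
      MvPolynomial.map_aeval, MvPolynomial.map_aeval]
    have hq : ∀ i, Ideal.Quotient.mk (Ideal.span {(X : κ[X]) ^ N}) (A i) =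
        Ideal.Quotient.mk (Ideal.span {(X : κ[X]) ^ N}) (B i) := fun i => by
      rw [Ideal.Quotient.eq, Ideal.mem_span_singleton]
      exact h i
    simp only [hq]
  have := X_pow_dvd_iff.1 hAB j hj
  rwa [coeff_sub, sub_eq_zero] at this

lemma X_dvd_carlitzAct_X (p : F[X]) : (X : κ[X]) ∣ carlitzAct 0 p X := by
  rw [X_dvd_iff, coeff_zero_eq_aeval_zero]
  have := map_carlitzAct (F := F) ((aeval (0 : κ)).restrictScalars F) 0 p (X : κ[X])
  simp only [AlgHom.restrictScalars_apply, map_zero, aeval_X] at this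
  rw [this, carlitzAct_apply_zero]

lemma X_pow_dvd_carlitzAct_sub {p r : F[X]} (h : polyToRk F k p = polyToRk F k r) :
    (X : κ[X]) ^ Fintype.card F ^ k ∣ carlitzAct 0 p X - carlitzAct 0 r X := by
  obtain ⟨u, hu⟩ := polyToRk_eq_iff.1 h
  rw [← carlitzAct_sub, hu, carlitzAct_mul, carlitzAct_X_pow, carlitz_zero_pow]
  exact pow_dvd_pow_of_dvd (X_dvd_carlitzAct_X u) _

lemma carlitzAct_zero_X_pow_eq_sum {K : ℕ} (c : Fin (K + 1) → F) (l : ℕ) :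
    (carlitzAct 0 (∑ j : Fin (K + 1), C (c j) * X ^ (j : ℕ)) (X : κ[X])) ^ Fintype.card F ^ l =
      ∑ j : Fin (K + 1), C (algebraMap F κ (c j)) * X ^ Fintype.card F ^ (j + l : ℕ) := by
  have h : carlitzAct 0 (∑ j : Fin (K + 1), C (c j) * X ^ (j : ℕ)) (X : κ[X]) =
      ∑ j : Fin (K + 1), c j • (carlitz F (0 : κ[X]) ^ (j : ℕ)) X := by
    simp [carlitzAct, Algebra.smul_def]
  rw [← carlitz_zero_pow, h, map_sum]
  refine Finset.sum_congr rfl fun j _ => ?_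
  rw [map_smul, ← Module.End.mul_apply, ← pow_add, carlitz_zero_pow, add_comm, Algebra.smul_def]
  rfl

end Curve

/-- **Polynomial method.** Polynomials dual to a family of coefficient functionals along curves
whose directions carry rich lines are no more numerous than the points of the set. -/
theorem card_le_of_dual_family {O : Type} [CommRing O] [IsDomain O] [ValuationRing O]
    [Algebra F O] {s y : O} (hs : s ∈ maximalIdeal O) (hym : y ∈ maximalIdeal O)
    (hy : (carlitz F s ^ k) y = 0)
    (hinj : ∀ p : F[X], carlitzAct s p y = 0 → X ^ k ∣ p)
    {ι : Type} [Fintype ι] (h : ι → MvPolynomial (Fin n) (ResidueField O))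
    (v : ι → Fin n → Rk F k) (j : ι → ℕ) {m : ℕ} (hj : ∀ b, j b < m)
    (E : Finset (Fin n → Rk F k))
    (hE : ∀ b, ∃ b₀ : Fin n → Rk F k, ∃ S : Finset (Rk F k), m ≤ S.card ∧
      ∀ r ∈ S, (fun i => b₀ i + r * v b i) ∈ E)
    (hdual : ∀ b b', (MvPolynomial.aeval (curve (ResidueField O) (v b')) (h b)).coeff (j b') =
      if b = b' then 1 else 0) :
    Fintype.card ι ≤ E.card := by
  by_contra! hlt
  have hres : ∀ {x : O}, x ∈ maximalIdeal O → algebraMap O (ResidueField O) x = 0 := fun hx =>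
    (residue_eq_zero_iff _).2 hx
  choose H hH using fun b => MvPolynomial.map_surjective (σ := Fin n)
    (algebraMap O (ResidueField O)) residue_surjective (h b)
  let pt : Rk F k → O := fun r => carlitzAct s (rep r) y
  have hpt : ∀ b r w : Rk F k, pt (b + r * w) = pt b + carlitzAct s (rep w) (pt r) := by
    intro b r w
    simp only [pt]
    rw [← carlitzAct_mul, ← carlitzAct_add]
    refine carlitzAct_eq_of_X_pow_dvd hy (polyToRk_eq_iff.1 ?_)
    simp [mul_comm]
  have hptinj : Function.Injective pt := by
    intro a b hab
    have := hinj (rep a - rep b) (by rw [carlitzAct_sub, sub_eq_zero]; exact hab)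
    simpa using polyToRk_eq_iff.2 this
  have hptm : ∀ r, algebraMap O (ResidueField O) (pt r) = 0 := by
    intro r
    have := map_carlitzAct (IsScalarTower.toAlgHom F O (ResidueField O)) s (rep r) y
    simp only [IsScalarTower.coe_toAlgHom', hres hym, carlitzAct_apply_zero] at this
    exact this
  obtain ⟨c, ⟨i, hci⟩, hc⟩ := ValuationRing.exists_primitive_solution
    (fun (e : E) b => MvPolynomial.eval (fun l => pt (e.1 l)) (H b))
    (by simpa using hlt)
  let P : MvPolynomial (Fin n) O := ∑ b, MvPolynomial.C (c b) * H b
  have hP : ∀ e ∈ E, MvPolynomial.eval (fun l => pt (e l)) P = 0 := fun e he => by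
    simpa [P] using hc ⟨e, he⟩
  obtain ⟨b₀, S, hS, hSE⟩ := hE i
  let g : Fin n → O[X] := fun l => C (pt (b₀ l)) + carlitzAct (C s) (rep (v i l)) X
  let G : O[X] := MvPolynomial.aeval g P
  have hG : ∀ r ∈ S, G.eval (pt r) = 0 := by
    intro r hr
    rw [← hP _ (hSE r hr)]
    have hg : ∀ l, (g l).eval (pt r) = pt (b₀ l + r * v i l) := by
      intro l
      have := map_carlitzAct (F := F) ((aeval (pt r)).restrictScalars F) (C s) (rep (v i l))
        (X : O[X])
      simp only [AlgHom.restrictScalars_apply, aeval_X, aeval_C, coe_aeval_eq_eval] at this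
      rw [hpt]
      simp only [g, eval_add, eval_C]
      rw [this]
      rfl
    have h1 := MvPolynomial.map_aeval g (evalRingHom (pt r)) P
    rw [coe_evalRingHom] at h1
    simp only [hg] at h1
    rw [show G.eval (pt r) = _ from h1]
    have h2 : (evalRingHom (pt r)).comp (algebraMap O O[X]) = RingHom.id O := by
      ext; simp
    rw [h2]
    rfl
  have hdvd : ∏ r ∈ S, (X - C (pt r)) ∣ G := by
    rcases eq_or_ne G 0 with h0 | h0
    · exact h0 ▸ dvd_zero _
    have h1 := (Multiset.prod_X_sub_C_dvd_iff_le_roots h0 (S.val.map pt)).2 (by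
      refine (Multiset.le_iff_subset (S.nodup.map hptinj)).2 fun x hx => ?_
      obtain ⟨r, hr, rfl⟩ := Multiset.mem_map.1 hx
      exact (mem_roots h0).2 (hG r hr))
    rwa [Multiset.map_map] at h1
  have hmap : G.map (algebraMap O (ResidueField O)) =
      MvPolynomial.aeval (curve (ResidueField O) (v i))
        (MvPolynomial.map (algebraMap O (ResidueField O)) P) := by
    have hg : ∀ l, (g l).map (algebraMap O (ResidueField O)) = curve _ (v i) l := by
      intro l
      have := map_carlitzAct (mapAlgHom (IsScalarTower.toAlgHom F O (ResidueField O)))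
        (C s) (rep (v i l)) (X : O[X])
      simp only [coe_mapAlgHom, map_C, map_X] at this
      simp only [g, Polynomial.map_add, map_C, hptm, map_zero, zero_add, curve]
      refine this.trans ?_
      simp [show residue O s = 0 from hres hs]
    have h1 := MvPolynomial.map_aeval g (mapRingHom (algebraMap O (ResidueField O))) P
    rw [coe_mapRingHom] at h1
    simp only [hg] at h1
    rw [show G.map (algebraMap O (ResidueField O)) = _ from h1, MvPolynomial.aeval_map_algebraMap]
    rw [MvPolynomial.aeval_def, MvPolynomial.coe_eval₂Hom]
    congr 1
    ext x
    simp [IsScalarTower.algebraMap_apply O (ResidueField O) (ResidueField O)[X]]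
  have hX : X ^ m ∣ G.map (algebraMap O (ResidueField O)) := by
    refine (pow_dvd_pow X hS).trans ?_
    have := Polynomial.map_dvd (algebraMap O (ResidueField O)) hdvd
    simpa [Polynomial.map_prod, show ∀ r, residue O (pt r) = 0 from hptm] using this
  have h0 := X_pow_dvd_iff.1 hX (j i) (hj i)
  rw [hmap] at h0
  simp only [P, map_sum, map_mul, MvPolynomial.map_C, hH, MvPolynomial.aeval_C, finsetSum_coeff]
    at h0
  simp only [algebraMap_eq, coeff_C_mul, hdual] at h0
  simp [hci] at h0

end PolynomialMethod

/-- A family of vectors with no common orthogonal vector contains a basis, with a dual family. -/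
lemma exists_dual_vectors {κ I J : Type} [Field κ] [Fintype J] (row : I → J → κ)
    (hrow : ∀ f : J → κ, (∀ i, ∑ j, f j * row i j = 0) → f = 0) :
    ∃ (a : J → I) (f : J → J → κ), ∀ b b', ∑ j, f b j * row (a b') j = if b = b' then 1 else 0 := by
  have hdot : ∀ (φ : (J → κ) →ₗ[κ] κ) (x : J → κ), φ x = ∑ j, φ (Pi.single j 1) * x j := by
    intro φ x
    conv_lhs => rw [pi_eq_sum_univ' x, map_sum]
    refine Finset.sum_congr rfl fun j _ => ?_
    rw [map_smul, smul_eq_mul, mul_comm]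
  have hspan : Submodule.span κ (Set.range row) = ⊤ := by
    by_contra h
    obtain ⟨φ, hφ0, hφ⟩ := Submodule.exists_le_ker_of_lt_top _ (lt_top_iff_ne_top.2 h)
    have h0 := hrow (fun j => φ (Pi.single j 1)) fun i => by
      rw [← hdot]
      exact hφ (Submodule.subset_span ⟨i, rfl⟩)
    refine hφ0 (LinearMap.ext fun x => ?_)
    rw [hdot]
    simp [congrFun h0]
  obtain ⟨B, a, -, hBspan, hBlin⟩ := exists_linearIndependent' κ row
  let β : Module.Basis B κ (J → κ) := Module.Basis.mk hBlin (by rw [hBspan, hspan])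
  let e : B ≃ J := β.indexEquiv (Pi.basisFun κ J)
  refine ⟨fun b => a (e.symm b), fun b j => β.coord (e.symm b) (Pi.single j 1), fun b b' => ?_⟩
  rw [← hdot]
  have : row (a (e.symm b')) = β (e.symm b') := by simp [β]
  rw [this, Module.Basis.coord_apply, Module.Basis.repr_self, Finsupp.single_apply]
  simp [eq_comm]

section Counting

open Polynomial IsLocalRing

variable {F : Type} [Field F] [Fintype F] {k n : ℕ}

/-- Coefficient functionals along curves with unit direction entries admit a large dual family. -/
theorem exists_dual_polynomials (κ : Type) [Field κ] [Algebra F κ] {q : ℕ}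
    (hq : Fintype.card F = q) {K m : ℕ} (hm : q ^ K * (n * K * (q - 1)) < m) (hmk : m ≤ q ^ k) :
    ∃ (w : (Fin n × Fin K → Fin q) → Fin n → Rk F k) (j : (Fin n × Fin K → Fin q) → ℕ)
      (f : (Fin n × Fin K → Fin q) → MvPolynomial (Fin n) κ),
      (∀ b i, IsUnit (w b i)) ∧ (∀ b, j b < m) ∧ ∀ b b',
        (MvPolynomial.aeval (curve κ (w b')) (f b)).coeff (j b') = if b = b' then 1 else 0 := by
  let mon : (Fin n × Fin K → Fin q) → MvPolynomial (Fin n) κ := fun α =>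
    ∏ p, (MvPolynomial.X p.1 ^ q ^ (p.2 : ℕ)) ^ (α p : ℕ)
  let row : {w : Fin n → Rk F k // ∀ i, IsUnit (w i)} × Fin m → (Fin n × Fin K → Fin q) → κ :=
    fun u α => (MvPolynomial.aeval (curve κ u.1.1) (mon α)).coeff u.2
  have hcomb : ∀ (f : (Fin n × Fin K → Fin q) → κ) (A : Fin n → κ[X]) (J : ℕ),
      (MvPolynomial.aeval A (∑ α, MvPolynomial.C (f α) * mon α)).coeff J =
        ∑ α, f α * (MvPolynomial.aeval A (mon α)).coeff J := by
    intro f A J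
    simp [algebraMap_eq]
  obtain ⟨a, f, haf⟩ := exists_dual_vectors row (by
    intro f hf
    by_contra hf0
    obtain ⟨ω, hω, J, hJ, hne⟩ := exists_coeff_ne_zero hq f hf0
    let P : Fin n → F[X] := fun i => ∑ j : Fin (K + 1), C (ω (i, j)) * X ^ (j : ℕ)
    have hP : ∀ i, IsUnit (polyToRk F k (P i)) := fun i => isUnit_polyToRk (by
      simp only [P, Fin.sum_univ_succ]
      simp [hω])
    have h : (MvPolynomial.aeval (curve κ fun i => polyToRk F k (P i))
        (∑ α, MvPolynomial.C (f α) * mon α)).coeff J = 0 := by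
      rw [hcomb]
      exact hf (⟨_, hP⟩, ⟨J, hJ.trans_lt hm⟩)
    rw [coeff_aeval_congr (A := curve κ fun i => polyToRk F k (P i))
      (B := fun i => carlitzAct 0 (P i) X)
      (fun i => X_pow_dvd_carlitzAct_sub (k := k) (by simp))
      _ ((hJ.trans_lt hm).trans_le (hq ▸ hmk))] at h
    refine hne ?_
    rw [← h]
    congr 1
    simp only [map_sum, map_mul, MvPolynomial.aeval_C, algebraMap_eq, mon, map_prod, map_pow,
      MvPolynomial.aeval_X]
    subst hq
    simp only [P, carlitzAct_zero_X_pow_eq_sum])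
  refine ⟨fun b => (a b).1.1, fun b => (a b).2,
    fun b => ∑ α, MvPolynomial.C (f b α) * mon α, fun b => (a b).1.2, fun b => (a b).2.2,
    fun b c => ?_⟩
  rw [hcomb]
  convert haf b c

/-- Counting rich directions with a unit entry in a fixed position. -/
theorem card_rich_directions_le (hk : 0 < k) {q : ℕ} (hq : Fintype.card F = q) {K m : ℕ}
    (hm : q ^ K * (n * K * (q - 1)) < m) (hmk : m ≤ q ^ k) (E D : Finset (Fin n → Rk F k))
    (i₀ : Fin n) (hDu : ∀ v ∈ D, IsUnit (v i₀))
    (hD : ∀ v ∈ D, ∃ b₀ : Fin n → Rk F k, ∃ S : Finset (Rk F k), m ≤ S.card ∧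
      ∀ r ∈ S, (fun i => b₀ i + r * v i) ∈ E) :
    q ^ (n * K) * D.card ≤ E.card * q ^ (k * n) := by
  have := Fintype.ofFinite (Rk F k)
  obtain ⟨k, rfl⟩ := Nat.exists_eq_succ_of_ne_zero hk.ne'
  obtain ⟨O, _, _, _, _, s, y, hs, hym, hy, hy'⟩ := exists_valuationRing_torsion F k
  obtain ⟨w, j, f, hw, hj, hdual⟩ :=
    exists_dual_polynomials (n := n) (ResidueField O) hq hm hmk
  let Φ : (Fin n × Fin K → Fin q) × (Fin n → Rk F (k + 1)) → Fin n → Rk F (k + 1) :=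
    fun u i => (w u.1 i - u.2 i) * Ring.inverse (u.2 i₀)
  have hΦ : ∀ u ∈ Finset.univ ×ˢ D, ∀ i, w u.1 i = u.2 i + Φ u i * u.2 i₀ := by
    intro u hu i
    have hu' := hDu _ (Finset.mem_product.1 hu).2
    simp only [Φ]
    rw [mul_assoc, Ring.inverse_mul_cancel _ hu']
    ring
  have hfib : ∀ c ∈ (Finset.univ : Finset (Fin n → Rk F (k + 1))),
      ((Finset.univ ×ˢ D).filter fun u => Φ u = c).card ≤ E.card := by
    intro c _
    set I := (Finset.univ ×ˢ D).filter fun u => Φ u = c with hI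
    have hmem : ∀ u : I, u.1.2 ∈ D ∧ ∀ i, w u.1.1 i = u.1.2 i + c i * u.1.2 i₀ := by
      rintro ⟨u, hu⟩
      obtain ⟨hu1, hu2⟩ := Finset.mem_filter.1 hu
      refine ⟨(Finset.mem_product.1 hu1).2, fun i => ?_⟩
      rw [← hu2]
      exact hΦ u hu1 i
    have hfst : ∀ u u' : I, u = u' ↔ u.1.1 = u'.1.1 := by
      refine fun u u' => ⟨fun h => h ▸ rfl, fun h => ?_⟩
      have h1 := (hmem u).2
      have h2 := (hmem u').2
      have hunit : IsUnit (1 + c i₀) := by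
        refine isUnit_of_mul_isUnit_left (y := u.1.2 i₀) ?_
        rw [add_mul, one_mul, ← h1]
        exact hw _ _
      have h0 : u.1.2 i₀ = u'.1.2 i₀ := by
        refine hunit.mul_left_cancel ?_
        rw [add_mul, one_mul, ← h1, add_mul, one_mul, ← h2, h]
      refine Subtype.ext (Prod.ext h (funext fun i => ?_))
      have h3 := h1 i
      rw [h, h2 i, h0] at h3
      exact (add_right_cancel h3).symm
    have := card_le_of_dual_family hs hym hy
      (fun p hp => X_pow_dvd_of_carlitzAct_eq_zero hy hy' hp) (ι := I)
      (fun u => MvPolynomial.aeval (fun i => MvPolynomial.X i +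
        carlitzAct 0 (rep (c i)) (MvPolynomial.X i₀)) (f u.1.1))
      (fun u => u.1.2) (fun u => j u.1.1) (fun u => hj _) E (fun u => hD _ (hmem u).1) (by
        intro u u'
        have hcomp := MvPolynomial.comp_aeval_apply (fun i => MvPolynomial.X i +
          carlitzAct 0 (rep (c i)) (MvPolynomial.X i₀))
          (MvPolynomial.aeval (curve (ResidueField O) u'.1.2)) (f u.1.1)
        rw [hcomp, coeff_aeval_congr (N := q ^ (k + 1)) (B := curve (ResidueField O) (w u'.1.1)) _ _
          ((hj _).trans_le hmk), hdual]
        · simp only [hfst]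
        · intro i
          let ψ : MvPolynomial (Fin n) (ResidueField O) →ₐ[F] (ResidueField O)[X] :=
            (MvPolynomial.aeval (curve (ResidueField O) u'.1.2)).restrictScalars F
          have hact : MvPolynomial.aeval (curve (ResidueField O) u'.1.2)
              (carlitzAct 0 (rep (c i))
                (MvPolynomial.X i₀ : MvPolynomial (Fin n) (ResidueField O))) =
              carlitzAct 0 (rep (c i)) (curve (ResidueField O) u'.1.2 i₀) := by
            have h := map_carlitzAct ψ 0 (rep (c i)) (MvPolynomial.X i₀)
            rw [map_zero, show ψ (MvPolynomial.X i₀) = _ from MvPolynomial.aeval_X _ i₀] at h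
            exact h
          rw [map_add, MvPolynomial.aeval_X, hact]
          simp only [curve]
          rw [← carlitzAct_mul, ← carlitzAct_add]
          have hdvd := X_pow_dvd_carlitzAct_sub (κ := ResidueField O) (k := k + 1)
            (p := rep (u'.1.2 i) + rep (c i) * rep (u'.1.2 i₀)) (r := rep (w u'.1.1 i))
            (by simp [(hmem u').2 i])
          rwa [hq] at hdvd)
    simpa using this
  have hcount := Finset.card_le_mul_card_image_of_maps_to
    (fun u _ => Finset.mem_univ (Φ u)) E.card hfib
  rw [Finset.card_product, Finset.card_univ, Finset.card_univ, Fintype.card_fun, Fintype.card_fun]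
    at hcount
  simp only [Fintype.card_prod, Fintype.card_fin] at hcount
  refine hcount.trans (Nat.mul_le_mul_left _ ?_)
  rw [pow_mul, ← hq, ← Nat.card_eq_fintype_card]
  exact Nat.pow_le_pow_left card_Rk_le _

end Counting

section Rich

variable {F : Type} [Field F] [Fintype F] {k n : ℕ}

/-- A large value of the maximal function of `𝟙_E` is witnessed by a line rich in points of `E`. -/
lemma exists_rich_line {E : Set (Fin n → Rk F k)} {w : Fin n → Rk F k} {lam : ℝ}
    (h : lam ≤ maxFn F (E.indicator fun _ => (1 : ℝ)) w) :
    ∃ b : Fin n → Rk F k, ∃ S : Finset (Rk F k), lam * (Fintype.card F : ℝ) ^ k ≤ S.card ∧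
      ∀ r ∈ S, (fun i => b i + r * w i) ∈ E := by
  have := Fintype.ofFinite (Rk F k)
  obtain ⟨b, hb⟩ := exists_eq_ciSup_of_finite (f := fun b : Fin n → Rk F k =>
    ((Fintype.card F : ℝ) ^ k)⁻¹ * ∑ᶠ v ∈ rline b w, |E.indicator (fun _ => (1 : ℝ)) v|)
  let S : Finset (Rk F k) := Finset.univ.filter fun r => (fun i => b i + r * w i) ∈ E
  refine ⟨b, S, ?_, fun r hr => (Finset.mem_filter.1 hr).2⟩
  rw [maxFn, ← hb, finsum_mem_eq_finite_toFinset_sum _ (Set.toFinite _)] at h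
  have hq : (0 : ℝ) < (Fintype.card F : ℝ) ^ k := pow_pos (by exact_mod_cast Fintype.card_pos) k
  rw [inv_mul_eq_div, le_div_iff₀ hq] at h
  refine h.trans ?_
  have hsum : ∑ v ∈ (Set.toFinite (rline b w)).toFinset, |E.indicator (fun _ => (1 : ℝ)) v| =
      (((Set.toFinite (rline b w)).toFinset.filter (· ∈ E)).card : ℝ) := by
    rw [Finset.card_filter, Nat.cast_sum]
    refine Finset.sum_congr rfl fun v _ => ?_
    by_cases hv : v ∈ E <;> simp [hv]
  rw [hsum]
  norm_cast
  refine (Finset.card_le_card (t := S.image fun r i => b i + r * w i) fun v hv => ?_).trans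
    Finset.card_image_le
  obtain ⟨hv, hvE⟩ := Finset.mem_filter.1 hv
  obtain ⟨r, rfl⟩ := (Set.Finite.mem_toFinset _).1 hv
  exact Finset.mem_image.2 ⟨r, by simpa [S] using hvE, rfl⟩

/-- A scale adapted to the number of points on rich lines. -/
lemma exists_scale {q k n m : ℕ} (hq : 2 ≤ q) (hk : 0 < k) (hn : 0 < n) (hm : 0 < m)
    (hmk : m ≤ q ^ k) :
    ∃ K, q ^ K * (n * K * (q - 1)) < m ∧ m ≤ n * k * q ^ 2 * q ^ K := by
  have hN : 0 < n * k * q := by positivity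
  refine ⟨Nat.log q ((m - 1) / (n * k * q)), ?_, ?_⟩
  · set K := Nat.log q ((m - 1) / (n * k * q)) with hK
    rcases Nat.eq_zero_or_pos K with h0 | h0
    · simpa [h0] using hm
    have h1 : q ^ K ≤ (m - 1) / (n * k * q) :=
      Nat.pow_log_le_self q (fun h => by simp [hK, h] at h0)
    rw [Nat.le_div_iff_mul_le hN] at h1
    have h2 : K < k := by
      refine (Nat.pow_lt_pow_iff_right (by omega : 1 < q)).1 ?_
      have := Nat.le_mul_of_pos_right (q ^ K) hN
      omega
    have h3 : q ^ K * (n * K * (q - 1)) ≤ q ^ K * (n * k * q) := by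
      gcongr
      omega
    omega
  · have h1 := Nat.lt_pow_succ_log_self (by omega : 1 < q) ((m - 1) / (n * k * q))
    rw [Nat.div_lt_iff_lt_mul hN] at h1
    have h2 : n * k * q ^ 2 * q ^ Nat.log q ((m - 1) / (n * k * q)) =
      q ^ (Nat.log q ((m - 1) / (n * k * q)) + 1) * (n * k * q) := by ring
    have h3 : (Nat.log q ((m - 1) / (n * k * q))).succ =
      Nat.log q ((m - 1) / (n * k * q)) + 1 := rfl
    rw [h2]
    rw [h3] at h1
    omega

/-- The weak-type estimate for rich directions with a unit entry in a fixed position. -/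
lemma card_rich_directions_mul_le (hk : 0 < k) (hn : 0 < n) {lam : ℝ} (hlam : 0 < lam)
    (E D : Finset (Fin n → Rk F k)) (i₀ : Fin n) (hDu : ∀ v ∈ D, IsUnit (v i₀))
    (hD : ∀ v ∈ D, lam ≤ maxFn F ((E : Set (Fin n → Rk F k)).indicator fun _ => (1 : ℝ)) v) :
    (D.card : ℝ) ≤
      (n * (Fintype.card F : ℝ) ^ 2) ^ n * (k : ℝ) ^ n * lam⁻¹ ^ n * E.card := by
  have := Fintype.ofFinite (Rk F k)
  obtain ⟨q, hq⟩ : ∃ q, Fintype.card F = q := ⟨_, rfl⟩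
  have hq2 : 2 ≤ q := hq ▸ Fintype.one_lt_card
  rcases D.eq_empty_or_nonempty with rfl | ⟨v, hv⟩
  · simp only [Finset.card_empty, Nat.cast_zero]
    positivity
  have hqk : (0 : ℝ) < (q : ℝ) ^ k := by positivity
  have hrich : ∀ v ∈ D, ∃ b : Fin n → Rk F k, ∃ S : Finset (Rk F k),
      ⌈lam * (q : ℝ) ^ k⌉₊ ≤ S.card ∧ ∀ r ∈ S, (fun i => b i + r * v i) ∈ E := by
    intro v hv
    obtain ⟨b, S, hS, hSE⟩ := exists_rich_line (hD v hv)
    exact ⟨b, S, Nat.ceil_le.2 (hq ▸ hS), fun r hr => by simpa using hSE r hr⟩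
  set m := ⌈lam * (q : ℝ) ^ k⌉₊ with hm
  have hm0 : 0 < m := Nat.ceil_pos.2 (by positivity)
  have hmk : m ≤ q ^ k := by
    obtain ⟨-, S, hS, -⟩ := hrich v hv
    refine hS.trans (S.card_le_univ.trans ?_)
    rw [← Nat.card_eq_fintype_card, ← hq]
    exact card_Rk_le
  obtain ⟨K, hK1, hK2⟩ := exists_scale hq2 hk hn hm0 hmk
  have hmain := card_rich_directions_le hk hq hK1 hmk E D i₀ hDu hrich
  have hbound : lam * (q : ℝ) ^ k ≤ n * k * q ^ 2 * q ^ K :=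
    (Nat.le_ceil _).trans (show (m : ℝ) ≤ _ by exact_mod_cast hK2)
  have hmain' : (q : ℝ) ^ (n * K) * D.card ≤ E.card * (q : ℝ) ^ (k * n) := by
    exact_mod_cast hmain
  have hpow : (lam * (q : ℝ) ^ k) ^ n ≤ (n * k * q ^ 2 * q ^ K) ^ n := by gcongr
  rw [hq]
  have hkey : (lam ^ n * (q : ℝ) ^ (k * n)) * D.card ≤
      (lam ^ n * (q : ℝ) ^ (k * n)) *
        ((n * (q : ℝ) ^ 2) ^ n * (k : ℝ) ^ n * lam⁻¹ ^ n * E.card) := by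
    calc (lam ^ n * (q : ℝ) ^ (k * n)) * D.card = (lam * (q : ℝ) ^ k) ^ n * D.card := by ring
      _ ≤ (n * k * q ^ 2 * q ^ K) ^ n * D.card := by gcongr
      _ = (n * k * q ^ 2) ^ n * ((q : ℝ) ^ (n * K) * D.card) := by ring
      _ ≤ (n * k * q ^ 2) ^ n * (E.card * (q : ℝ) ^ (k * n)) := by gcongr
      _ = (lam ^ n * (q : ℝ) ^ (k * n)) *
          ((n * (q : ℝ) ^ 2) ^ n * (k : ℝ) ^ n * lam⁻¹ ^ n * E.card) := by
        rw [inv_pow]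
        field_simp
        ring
  exact le_of_mul_le_mul_left hkey (by positivity)

end Rich

/-- **Restricted weak-type estimate.** There is a constant `C(n,q) > 0` such
that for every `k > 0`, every subset `E ⊆ R^n` and every `λ > 0`, the number of
primitive vectors `w ∈ S^{n-1}(R)` with `𝟙_E*(w) ≥ λ` is at most
`C(n,q)·k^n·λ^{-n}·|E|`. -/
theorem kakeya_restricted_weak_type
    (Fq : Type) [Field Fq] [Fintype Fq] (n : ℕ) (hn : 1 ≤ n) :
    ∃ C : ℝ, 0 < C ∧
      ∀ k : ℕ, 0 < k → ∀ E : Set (Fin n → Rk Fq k), ∀ lam : ℝ, 0 < lam →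
        ({w ∈ primSet Fq n k |
            lam ≤ maxFn Fq (E.indicator fun _ => (1 : ℝ)) w}.ncard : ℝ)
          ≤ C * (k : ℝ) ^ n * lam⁻¹ ^ n * E.ncard := by
  have hq : (0 : ℝ) < Fintype.card Fq := by exact_mod_cast Fintype.card_pos
  have hn' : (0 : ℝ) < n := by exact_mod_cast hn
  refine ⟨n * (n * (Fintype.card Fq : ℝ) ^ 2) ^ n, by positivity, fun k hk E lam hlam => ?_⟩
  have := Fintype.ofFinite (Rk Fq k)
  set W := {w ∈ primSet Fq n k | lam ≤ maxFn Fq (E.indicator fun _ => (1 : ℝ)) w} with hW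
  let D : Fin n → Finset (Fin n → Rk Fq k) := fun i => W.toFinset.filter fun w => IsUnit (w i)
  have hcover : W.toFinset ⊆ Finset.univ.biUnion D := by
    intro w hw
    have hprim : w ∈ primSet Fq n k := (Set.mem_toFinset.1 hw).1
    obtain ⟨i, hi⟩ := not_forall.1 hprim
    exact Finset.mem_biUnion.2 ⟨i, Finset.mem_univ _, Finset.mem_filter.2
      ⟨hw, isUnit_of_not_tbar_dvd hi⟩⟩
  rw [Set.ncard_eq_toFinset_card', Set.ncard_eq_toFinset_card']
  calc (W.toFinset.card : ℝ) ≤ ∑ i, ((D i).card : ℝ) := by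
        exact_mod_cast (Finset.card_le_card hcover).trans Finset.card_biUnion_le
    _ ≤ ∑ _i : Fin n, (n * (Fintype.card Fq : ℝ) ^ 2) ^ n * (k : ℝ) ^ n * lam⁻¹ ^ n *
          E.toFinset.card := by
        refine Finset.sum_le_sum fun i _ => card_rich_directions_mul_le hk hn hlam _ _ i
          (fun v hv => (Finset.mem_filter.1 hv).2) fun v hv => ?_
        rw [Set.coe_toFinset]
        exact (Set.mem_toFinset.1 (Finset.mem_filter.1 hv).1).2
    _ = _ := by
        simp only [Finset.sum_const, Finset.card_univ, Fintype.card_fin, nsmul_eq_mul]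
        ring
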